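/- Let A₂, A₃, A₄ be pairwise transverse affine parabolic spaces in 𝔰𝔩ₙ(ℝ) and let A_* be an affine parabolic space transverse to each of A₂, A₃, A₄. Then δ(A₂,A₃,A₄) = β(A_*,A₂,A₃,A₄) + β(A_*,A₃,A₄,A₂) + β(A_*,A₄,A₂,A₃). -/

import Mathlib

open Matrix

noncomputable section

abbrev Mn (n : ℕ) := Matrix (Fin n) (Fin n) ℝ

/-- Conjugation `Z ↦ g Z g⁻¹` as a linear map on matrices. -/
def AdM {n : ℕ} (g : Mn n) : Mn n →ₗ[ℝ] Mn n where
  toFun Z := g * Z * g⁻¹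
  map_add' X Y := by simp [Matrix.add_mul, Matrix.mul_add]
  map_smul' c X := by simp [Matrix.smul_mul, Matrix.mul_smul]

/-- Projection onto the diagonal part. -/
def pi0 {n : ℕ} : Mn n →ₗ[ℝ] Mn n where
  toFun Z := Matrix.diagonal (fun i => Z i i)
  map_add' X Y := by
    ext i j
    by_cases h : i = j <;> simp [Matrix.diagonal_apply, h]
  map_smul' c X := by
    ext i j
    by_cases h : i = j <;> simp [Matrix.diagonal_apply, h]

/-- The involution reversing the diagonal entries (on diagonal matrices). -/
def omega0 {n : ℕ} : Mn n →ₗ[ℝ] Mn n where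
  toFun Z := Matrix.diagonal (fun i => Z i.rev i.rev)
  map_add' X Y := by
    ext i j
    by_cases h : i = j <;> simp [Matrix.diagonal_apply, h]
  map_smul' c X := by
    ext i j
    by_cases h : i = j <;> simp [Matrix.diagonal_apply, h]

/-- Traceless matrices: 𝔰𝔩ₙ(ℝ). -/
def slSub (n : ℕ) : Submodule ℝ (Mn n) := LinearMap.ker (Matrix.traceLinearMap (Fin n) ℝ ℝ)

/-- Matrices vanishing below the diagonal (upper triangular). -/
def upTri (n : ℕ) : Submodule ℝ (Mn n) where
  carrier := {Z | ∀ i j : Fin n, j < i → Z i j = 0}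
  add_mem' := by intro a b ha hb i j h; simp [Matrix.add_apply, ha i j h, hb i j h]
  zero_mem' := by intro i j h; rfl
  smul_mem' := by intro c a ha i j h; simp [Matrix.smul_apply, ha i j h]

/-- Matrices vanishing above the diagonal (lower triangular). -/
def loTri (n : ℕ) : Submodule ℝ (Mn n) where
  carrier := {Z | ∀ i j : Fin n, i < j → Z i j = 0}
  add_mem' := by intro a b ha hb i j h; simp [Matrix.add_apply, ha i j h, hb i j h]
  zero_mem' := by intro i j h; rfl
  smul_mem' := by intro c a ha i j h; simp [Matrix.smul_apply, ha i j h]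

/-- Diagonal matrices. -/
def diagSub (n : ℕ) : Submodule ℝ (Mn n) where
  carrier := {Z | ∀ i j : Fin n, i ≠ j → Z i j = 0}
  add_mem' := by intro a b ha hb i j h; simp [Matrix.add_apply, ha i j h, hb i j h]
  zero_mem' := by intro i j h; rfl
  smul_mem' := by intro c a ha i j h; simp [Matrix.smul_apply, ha i j h]

/-- Strictly upper triangular matrices: 𝔫⁺. -/
def nplus (n : ℕ) : Submodule ℝ (Mn n) where
  carrier := {Z | ∀ i j : Fin n, j ≤ i → Z i j = 0}
  add_mem' := by intro a b ha hb i j h; simp [Matrix.add_apply, ha i j h, hb i j h]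
  zero_mem' := by intro i j h; rfl
  smul_mem' := by intro c a ha i j h; simp [Matrix.smul_apply, ha i j h]

/-- Strictly lower triangular matrices: 𝔫⁻. -/
def nminus (n : ℕ) : Submodule ℝ (Mn n) where
  carrier := {Z | ∀ i j : Fin n, i ≤ j → Z i j = 0}
  add_mem' := by intro a b ha hb i j h; simp [Matrix.add_apply, ha i j h, hb i j h]
  zero_mem' := by intro i j h; rfl
  smul_mem' := by intro c a ha i j h; simp [Matrix.smul_apply, ha i j h]

/-- 𝔟⁺ : traceless upper triangular matrices. -/
def bplus (n : ℕ) : Submodule ℝ (Mn n) := slSub n ⊓ upTri n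

/-- 𝔟⁻ : traceless lower triangular matrices. -/
def bminus (n : ℕ) : Submodule ℝ (Mn n) := slSub n ⊓ loTri n

/-- 𝔞 : traceless diagonal matrices. -/
def aSub (n : ℕ) : Submodule ℝ (Mn n) := slSub n ⊓ diagSub n

/-- A parabolic subspace of 𝔰𝔩ₙ(ℝ): a subspace of the form Ad(g)𝔟⁺ with g ∈ SLₙ(ℝ). -/
def IsParabolic {n : ℕ} (V : Submodule ℝ (Mn n)) : Prop :=
  ∃ g : Mn n, g.det = 1 ∧ V = (bplus n).map (AdM g)

/-- Two subspaces are transverse if together they span 𝔰𝔩ₙ(ℝ). -/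
def Transv {n : ℕ} (V W : Submodule ℝ (Mn n)) : Prop := V ⊔ W = slSub n

/-- A standardizer of an ordered transverse pair of parabolic subspaces. -/
def IsStd {n : ℕ} (h : Mn n) (V₁ V₂ : Submodule ℝ (Mn n)) : Prop :=
  h.det = 1 ∧ (bplus n).map (AdM h) = V₁ ∧ (bminus n).map (AdM h) = V₂

/-- ν*_{i,j} computed with the standardizer h. -/
def nustar {n : ℕ} (h : Mn n) : Mn n →ₗ[ℝ] Mn n := pi0 ∘ₗ AdM h⁻¹

/-- ν_{i,j} computed with the standardizer h. -/
def nuMap {n : ℕ} (h : Mn n) : Mn n →ₗ[ℝ] Mn n := AdM h ∘ₗ pi0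

/-- π_{i,j} computed with the standardizer h. -/
def piStd {n : ℕ} (h : Mn n) : Mn n →ₗ[ℝ] Mn n := AdM h ∘ₗ pi0 ∘ₗ AdM h⁻¹

/-- The commutator subspace [V,V]. -/
def commSub {n : ℕ} (V : Submodule ℝ (Mn n)) : Submodule ℝ (Mn n) :=
  Submodule.span ℝ {z | ∃ x ∈ V, ∃ y ∈ V, z = x * y - y * x}

/-- An affine parabolic space with direction V: an affine subspace X + V of 𝔰𝔩ₙ(ℝ)
whose direction V is a parabolic subspace. -/
def IsAffPara {n : ℕ} (A : Set (Mn n)) (V : Submodule ℝ (Mn n)) : Prop :=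
  IsParabolic V ∧ ∃ X : Mn n, X ∈ slSub n ∧ A = {Z | Z - X ∈ V}

/-- `IsCross b A₁ A₂ A₃ A₄ V₁ V₂ V₃ V₄` : b is a value of the affine cross ratio
β(A₁,A₂,A₃,A₄), computed with some choice of standardizers and intersection points. -/
def IsCross {n : ℕ} (b : Mn n) (A₁ A₂ A₃ A₄ : Set (Mn n))
    (V₁ V₂ V₃ V₄ : Submodule ℝ (Mn n)) : Prop :=
  ∃ h₁₄ h₂₃ : Mn n, ∃ X₁₃ X₂₄ : Mn n,
    IsStd h₁₄ V₁ V₄ ∧ IsStd h₂₃ V₂ V₃ ∧ X₁₃ ∈ A₁ ∩ A₃ ∧ X₂₄ ∈ A₂ ∩ A₄ ∧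
    b = nustar h₁₄ (X₁₃ - X₂₄) - nustar h₂₃ (X₁₃ - X₂₄)

/-- `IsTriple d A₂ A₃ A₄ V₂ V₃ V₄` : d is a value of the affine triple ratio
δ(A₂,A₃,A₄), computed with some choice of standardizers and points. -/
def IsTriple {n : ℕ} (d : Mn n) (A₂ A₃ A₄ : Set (Mn n))
    (V₂ V₃ V₄ : Submodule ℝ (Mn n)) : Prop :=
  ∃ h₂₃ h₃₂ h₃₄ h₄₃ h₄₂ h₂₄ : Mn n, ∃ X₂ X₃ X₄ : Mn n,
    IsStd h₂₃ V₂ V₃ ∧ IsStd h₃₂ V₃ V₂ ∧ IsStd h₃₄ V₃ V₄ ∧ IsStd h₄₃ V₄ V₃ ∧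
    IsStd h₄₂ V₄ V₂ ∧ IsStd h₂₄ V₂ V₄ ∧ X₂ ∈ A₂ ∧ X₃ ∈ A₃ ∧ X₄ ∈ A₄ ∧
    d = (nustar h₂₃ (X₂ - X₃) + nustar h₃₂ (X₂ - X₃))
      + (nustar h₃₄ (X₃ - X₄) + nustar h₄₃ (X₃ - X₄))
      + (nustar h₄₂ (X₄ - X₂) + nustar h₂₄ (X₄ - X₂))

/-- The affine action of (g,Y) ∈ SLₙ(ℝ) ⋉ 𝔰𝔩ₙ(ℝ) on 𝔰𝔩ₙ(ℝ). -/
def affMap {n : ℕ} (g Y : Mn n) : Mn n → Mn n := fun Z => g * Z * g⁻¹ + Y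

section Standardizers

variable {n : ℕ}

lemma AdM_apply (g Z : Mn n) : AdM g Z = g * Z * g⁻¹ := rfl

lemma AdM_mul (g h : Mn n) : AdM (g * h) = AdM g ∘ₗ AdM h := by
  ext1 Z
  simp [AdM_apply, Matrix.mul_inv_rev, Matrix.mul_assoc]

lemma AdM_one : AdM (1 : Mn n) = LinearMap.id := by
  ext1 Z
  simp [AdM_apply]

lemma AdM_inv_AdM {g : Mn n} (hg : IsUnit g.det) (Z : Mn n) : AdM g⁻¹ (AdM g Z) = Z := by
  rw [← LinearMap.comp_apply, ← AdM_mul, Matrix.nonsing_inv_mul g hg, AdM_one, LinearMap.id_apply]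

lemma trace_AdM {g : Mn n} (hg : IsUnit g.det) (Z : Mn n) : (AdM g Z).trace = Z.trace := by
  rw [AdM_apply, Matrix.trace_mul_comm, ← Matrix.mul_assoc, Matrix.nonsing_inv_mul g hg,
    Matrix.one_mul]

lemma mem_slSub {Z : Mn n} : Z ∈ slSub n ↔ Z.trace = 0 := Iff.rfl

/-- An invertible matrix whose conjugation preserves `𝔟⁺` is upper triangular. -/
lemma blockTriangular_of_AdM_bplus {k : Mn n} (hk : IsUnit k.det)
    (hb : ∀ Z ∈ bplus n, AdM k Z ∈ bplus n) : k.BlockTriangular id := by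
  intro a i hia
  by_contra hne
  have key : ∀ j b, i < j → b < a → k⁻¹ j b = 0 := by
    intro j b hij hba
    have hmem : Matrix.single i j (1 : ℝ) ∈ bplus n := by
      refine ⟨?_, ?_⟩
      · rw [SetLike.mem_coe, mem_slSub, Matrix.trace_single_eq_of_ne _ _ _ hij.ne]
      · intro p q hqp
        rw [Matrix.single_apply, if_neg]
        rintro ⟨rfl, rfl⟩
        exact absurd hij hqp.not_gt
    have h0 := (hb _ hmem).2 a b hba
    rw [AdM_apply, Matrix.mul_apply, Finset.sum_eq_single j] at h0
    · simpa [hne] using h0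
    · intro c _ hc
      rw [Matrix.mul_single_apply_of_ne _ _ _ _ _ hc, zero_mul]
    · simp
  have hinv : k⁻¹.BlockTriangular (fun x => decide (i < x)) := by
    intro j b hjb
    obtain ⟨hb', hj'⟩ := Bool.lt_iff.mp hjb
    exact key j b (of_decide_eq_true hj') (lt_of_le_of_lt (not_lt.mp (of_decide_eq_false hb')) hia)
  let : Invertible k⁻¹ := Matrix.invertibleOfIsUnitDet _ (Matrix.isUnit_nonsing_inv_det k hk)
  have hk' := Matrix.blockTriangular_inv_of_blockTriangular hinv
  rw [Matrix.nonsing_inv_nonsing_inv k hk] at hk'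
  refine hne (hk' ?_)
  have hia' : i < a := hia
  simp [hia']

lemma mul_apply_diag_of_blockTriangular {M N : Mn n} (hM : M.BlockTriangular id)
    (hN : N.BlockTriangular id) (a : Fin n) : (M * N) a a = M a a * N a a := by
  rw [Matrix.mul_apply, Finset.sum_eq_single a]
  · intro c _ hc
    rcases lt_or_gt_of_ne hc with h | h
    · rw [hM h, zero_mul]
    · rw [hN h, mul_zero]
  · simp

lemma pi0_AdM_of_preserves_bplus {k : Mn n} (hk : IsUnit k.det)
    (hb : ∀ Z ∈ bplus n, AdM k Z ∈ bplus n) {Z : Mn n} (hZ : Z ∈ bplus n) :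
    pi0 (AdM k Z) = pi0 Z := by
  have hT := blockTriangular_of_AdM_bplus hk hb
  let : Invertible k := Matrix.invertibleOfIsUnitDet _ hk
  have hI := Matrix.blockTriangular_inv_of_blockTriangular hT
  have hZT : Z.BlockTriangular id := fun i j h => hZ.2 i j h
  refine congrArg Matrix.diagonal (funext fun a => ?_)
  have h1 : k a a * k⁻¹ a a = 1 := by
    rw [← mul_apply_diag_of_blockTriangular hT hI, Matrix.mul_nonsing_inv k hk,
      Matrix.one_apply_eq]
  rw [AdM_apply, mul_apply_diag_of_blockTriangular (hT.mul hZT) hI,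
    mul_apply_diag_of_blockTriangular hT hZT, mul_right_comm, h1, one_mul]

/-- On a parabolic subspace `V`, the map `ν*` depends only on `V`. -/
lemma nustar_eq_of_map_bplus_eq {g h : Mn n} (hg : IsUnit g.det) (hh : IsUnit h.det)
    {V : Submodule ℝ (Mn n)} (eg : (bplus n).map (AdM g) = V) (eh : (bplus n).map (AdM h) = V)
    {v : Mn n} (hv : v ∈ V) : nustar g v = nustar h v := by
  have hk : IsUnit (h⁻¹ * g).det := by
    rw [Matrix.det_mul]
    exact (Matrix.isUnit_nonsing_inv_det h hh).mul hg
  have hb : ∀ Z ∈ bplus n, AdM (h⁻¹ * g) Z ∈ bplus n := by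
    intro Z hZ
    have hgZ : AdM g Z ∈ (bplus n).map (AdM h) := by
      rw [eh, ← eg]
      exact Submodule.mem_map_of_mem hZ
    obtain ⟨W, hW, hWZ⟩ := hgZ
    rwa [AdM_mul, LinearMap.comp_apply, ← hWZ, AdM_inv_AdM hh]
  rw [← eg] at hv
  obtain ⟨Z, hZ, rfl⟩ := hv
  have := pi0_AdM_of_preserves_bplus hk hb hZ
  rw [AdM_mul, LinearMap.comp_apply] at this
  rw [nustar, nustar, LinearMap.comp_apply, LinearMap.comp_apply, AdM_inv_AdM hg, this]

/-- The permutation matrix of the order-reversing permutation. -/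
def revMatrix (n : ℕ) : Mn n := (1 : Mn n).submatrix Fin.rev id

lemma revMatrix_mul (Z : Mn n) : revMatrix n * Z = Z.submatrix Fin.rev id := by
  ext i j
  simp [revMatrix, Matrix.mul_apply, Matrix.one_apply]

lemma mul_revMatrix (Z : Mn n) : Z * revMatrix n = Z.submatrix id Fin.rev := by
  ext i j
  simp [revMatrix, Matrix.mul_apply, Matrix.one_apply, Fin.rev_eq_iff]

lemma revMatrix_mul_self : revMatrix n * revMatrix n = 1 := by
  rw [revMatrix_mul]
  ext i j
  rw [revMatrix, Matrix.submatrix_apply, Matrix.submatrix_apply, Fin.rev_rev, id, id]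

lemma revMatrix_inv : (revMatrix n)⁻¹ = revMatrix n :=
  Matrix.inv_eq_left_inv revMatrix_mul_self

lemma isUnit_det_revMatrix : IsUnit (revMatrix n).det :=
  Matrix.isUnit_det_of_left_inverse revMatrix_mul_self

lemma AdM_revMatrix_apply (Z : Mn n) (i j : Fin n) :
    AdM (revMatrix n) Z i j = Z i.rev j.rev := by
  rw [AdM_apply, revMatrix_inv, mul_revMatrix, revMatrix_mul]
  rfl

lemma AdM_revMatrix_involutive (Z : Mn n) : AdM (revMatrix n) (AdM (revMatrix n) Z) = Z := by
  ext i j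
  simp [AdM_revMatrix_apply]

lemma map_AdM_revMatrix_bplus : (bplus n).map (AdM (revMatrix n)) = bminus n := by
  ext Z
  constructor
  · rintro ⟨W, hW, rfl⟩
    refine ⟨?_, fun i j hij => ?_⟩
    · exact mem_slSub.mpr ((trace_AdM isUnit_det_revMatrix W).trans hW.1)
    · rw [AdM_revMatrix_apply]
      exact hW.2 _ _ (Fin.rev_lt_rev.mpr hij)
  · intro hZ
    refine ⟨AdM (revMatrix n) Z, ⟨?_, fun i j hij => ?_⟩, AdM_revMatrix_involutive Z⟩
    · exact mem_slSub.mpr ((trace_AdM isUnit_det_revMatrix Z).trans hZ.1)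
    · rw [AdM_revMatrix_apply]
      exact hZ.2 _ _ (Fin.rev_lt_rev.mpr hij)

lemma nustar_mul_revMatrix (h v : Mn n) : omega0 (nustar (h * revMatrix n) v) = nustar h v := by
  rw [nustar, nustar, Matrix.mul_inv_rev, revMatrix_inv, AdM_mul]
  ext i j
  simp [omega0, pi0, AdM_revMatrix_apply]

lemma IsStd.isUnit_det {h : Mn n} {V W : Submodule ℝ (Mn n)} (s : IsStd h V W) :
    IsUnit h.det := by
  rw [s.1]
  exact isUnit_one

lemma IsStd.nustar_eq_left {g h : Mn n} {V W W' : Submodule ℝ (Mn n)} (sg : IsStd g V W)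
    (sh : IsStd h V W') {v : Mn n} (hv : v ∈ V) : nustar g v = nustar h v :=
  nustar_eq_of_map_bplus_eq sg.isUnit_det sh.isUnit_det sg.2.1 sh.2.1 hv

lemma IsStd.nustar_eq_right {g h : Mn n} {U V W : Submodule ℝ (Mn n)} (sg : IsStd g U V)
    (sh : IsStd h V W) {v : Mn n} (hv : v ∈ V) : nustar g v = omega0 (nustar h v) := by
  have hu : IsUnit (g * revMatrix n).det := by
    rw [Matrix.det_mul]
    exact sg.isUnit_det.mul isUnit_det_revMatrix
  have he : (bplus n).map (AdM (g * revMatrix n)) = V := by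
    rw [AdM_mul, Submodule.map_comp, map_AdM_revMatrix_bplus, sg.2.2]
  rw [← nustar_mul_revMatrix g v, nustar_eq_of_map_bplus_eq hu sh.isUnit_det he sh.2.1 hv]

/-- Splitting `ν*_{i,j}(X - Y)` through `P`, where `X - P ∈ V_i` and `P - Y ∈ V_j`. -/
lemma IsStd.nustar_sub_split {g h k : Mn n} {V W V' W' : Submodule ℝ (Mn n)} (sg : IsStd g V W)
    (sh : IsStd h V V') (sk : IsStd k W W') {X P Y : Mn n} (hX : X - P ∈ V) (hY : P - Y ∈ W) :
    nustar g (X - Y) = nustar h X - nustar h P + (omega0 (nustar k P) - omega0 (nustar k Y)) := by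
  rw [← sub_add_sub_cancel X P Y, map_add, sg.nustar_eq_left sh hX, sg.nustar_eq_right sk hY]
  simp only [map_sub]

lemma IsStd.nustar_sub_split' {g h k : Mn n} {V W V' W' : Submodule ℝ (Mn n)} (sg : IsStd g V W)
    (sh : IsStd h V V') (sk : IsStd k W W') {X P Y : Mn n} (hX : X - P ∈ W) (hY : P - Y ∈ V) :
    nustar g (X - Y) = omega0 (nustar k X) - omega0 (nustar k P) + (nustar h P - nustar h Y) := by
  rw [← sub_add_sub_cancel X P Y, map_add, sg.nustar_eq_left sh hY, sg.nustar_eq_right sk hX]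
  simp only [map_sub]

lemma IsAffPara.sub_mem {A : Set (Mn n)} {V : Submodule ℝ (Mn n)} (hA : IsAffPara A V)
    {X Y : Mn n} (hX : X ∈ A) (hY : Y ∈ A) : X - Y ∈ V := by
  obtain ⟨-, P, -, rfl⟩ := hA
  simpa using V.sub_mem hX hY

end Standardizers

/-- Let A₂, A₃, A₄ be pairwise transverse affine parabolic spaces and A_*
an affine parabolic space transverse to each of them. Then
δ(A₂,A₃,A₄) = β(A_*,A₂,A₃,A₄) + β(A_*,A₃,A₄,A₂) + β(A_*,A₄,A₂,A₃). -/
theorem affine_triple_ratio_from_cross_ratios (n : ℕ) (hn : 2 ≤ n)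
    (A₂ A₃ A₄ As : Set (Mn n)) (V₂ V₃ V₄ Vs : Submodule ℝ (Mn n))
    (h₂ : IsAffPara A₂ V₂) (h₃ : IsAffPara A₃ V₃) (h₄ : IsAffPara A₄ V₄)
    (hs : IsAffPara As Vs)
    (t₂₃ : Transv V₂ V₃) (t₂₄ : Transv V₂ V₄) (t₃₄ : Transv V₃ V₄)
    (ts₂ : Transv Vs V₂) (ts₃ : Transv Vs V₃) (ts₄ : Transv Vs V₄) :
    ∀ d b₁ b₂ b₃ : Mn n,
      IsTriple d A₂ A₃ A₄ V₂ V₃ V₄ →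
      IsCross b₁ As A₂ A₃ A₄ Vs V₂ V₃ V₄ →
      IsCross b₂ As A₃ A₄ A₂ Vs V₃ V₄ V₂ →
      IsCross b₃ As A₄ A₂ A₃ Vs V₄ V₂ V₃ →
      d = b₁ + b₂ + b₃ := by
  rintro _ _ _ _
    ⟨h23, h32, h34, h43, h42, h24, Y2, Y3, Y4, s23, s32, s34, s43, s42, s24, m2, m3, m4, rfl⟩
    ⟨g1, k1, Xs3, X24, t1, u1, ⟨p1, q1⟩, ⟨r1, w1⟩, rfl⟩
    ⟨g2, k2, Xs4, X32, t2, u2, ⟨p2, q2⟩, ⟨r2, w2⟩, rfl⟩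
    ⟨g3, k3, Xs2, X43, t3, u3, ⟨p3, q3⟩, ⟨r3, w3⟩, rfl⟩
  rw [s23.nustar_sub_split s23 s34 (h₂.sub_mem m2 w2) (h₃.sub_mem r2 m3),
    s32.nustar_sub_split' s34 s23 (h₂.sub_mem m2 w2) (h₃.sub_mem r2 m3),
    s34.nustar_sub_split s34 s42 (h₃.sub_mem m3 w3) (h₄.sub_mem r3 m4),
    s43.nustar_sub_split' s42 s34 (h₃.sub_mem m3 w3) (h₄.sub_mem r3 m4),
    s42.nustar_sub_split s42 s23 (h₄.sub_mem m4 w1) (h₂.sub_mem r1 m2),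
    s24.nustar_sub_split' s23 s42 (h₄.sub_mem m4 w1) (h₂.sub_mem r1 m2),
    t1.nustar_sub_split t1 s42 (hs.sub_mem p1 p2) (h₄.sub_mem q2 w1),
    t2.nustar_sub_split t1 s23 (hs.sub_mem p2 p3) (h₂.sub_mem q3 w2),
    t3.nustar_sub_split t1 s34 (hs.sub_mem p3 p1) (h₃.sub_mem q1 w3),
    u1.nustar_sub_split' s23 s34 (h₃.sub_mem q1 r2) (h₂.sub_mem w2 r1),
    u2.nustar_sub_split' s34 s42 (h₄.sub_mem q2 r3) (h₃.sub_mem w3 r2),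
    u3.nustar_sub_split' s42 s23 (h₂.sub_mem q3 r1) (h₄.sub_mem w1 r3)]
  abel

end
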